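/- arXiv:1611.00052 — 3 statements merged into one kernel-verified Lean document; each statement's English description precedes it below -/
import Mathlib

section
/- Let M ≥ 1 and let σ_0, σ_1, …, σ_M and β_0, β_1, …, β_M be positive reals with σ_i ≥ 3·σ_{i-1} and β_i ≤ β_{i-1}/9 for every i ∈ {1,…,M}. Then for every real x ≥ 0 and every j ∈ {1,…,M}: Σ_{i=1}^{M} min(σ_i, β_{i-1}·x) ≤ (3/2)·σ_j + (9/8)·β_j·x; in particular Σ_{i=1}^{M} min(σ_i, β_{i-1}·x) ≤ (3/2)·(σ_j + β_j·x). -/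
/-- A positive sequence growing by a factor of at least `3` has partial sums bounded by `3 / 2`
times the last term. -/
theorem sum_Icc_le_of_three_mul_le (M : ℕ) (σ : ℕ → ℝ) (h0 : 0 ≤ σ 0)
    (hσ : ∀ i, 1 ≤ i → i ≤ M → 3 * σ (i - 1) ≤ σ i) :
    ∀ n ≤ M, ∑ i ∈ Finset.Icc 1 n, σ i ≤ (3 / 2) * σ n := by
  intro n
  induction n with
  | zero => intro _; simpa using h0
  | succ k ih =>
    intro hk
    rw [Finset.sum_Icc_succ_top (by omega)]
    have h1 := ih (by omega)
    have h2 := hσ (k + 1) (by omega) hk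
    rw [Nat.add_sub_cancel] at h2
    linarith

/-- Splitting the rent-or-buy sum at `j`: the terms up to `j` are bounded by the fixed costs, the
remaining ones by a telescoping bound on the incremental costs. -/
theorem sum_min_le_of_geometric (M : ℕ) (σ β : ℕ → ℝ) (h0 : 0 ≤ σ 0)
    (hσ : ∀ i, 1 ≤ i → i ≤ M → 3 * σ (i - 1) ≤ σ i)
    (hβ : ∀ i, 1 ≤ i → i ≤ M → β i ≤ β (i - 1) / 9)
    (x : ℝ) (hx : 0 ≤ x) (j n : ℕ) (hjn : j ≤ n) (hn : n ≤ M) :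
    ∑ i ∈ Finset.Icc 1 n, min (σ i) (β (i - 1) * x)
      ≤ (3 / 2) * σ j + (9 / 8) * (β j - β n) * x := by
  induction n, hjn using Nat.le_induction with
  | base =>
    have h1 : ∑ i ∈ Finset.Icc 1 j, min (σ i) (β (i - 1) * x) ≤ ∑ i ∈ Finset.Icc 1 j, σ i :=
      Finset.sum_le_sum fun i _ => min_le_left _ _
    have h2 := sum_Icc_le_of_three_mul_le M σ h0 hσ j hn
    rw [sub_self]
    linarith
  | succ k _ ih =>
    rw [Finset.sum_Icc_succ_top (by omega), Nat.add_sub_cancel]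
    have h1 := ih (by omega)
    have h2 := hβ (k + 1) (by omega) hn
    rw [Nat.add_sub_cancel] at h2
    have h3 := mul_le_mul_of_nonneg_right h2 hx
    have h4 := min_le_right (σ (k + 1)) (β k * x)
    linarith

/-- **Pointwise inequality in Lemma 2 (OPT decomposition).**
Given `M ≥ 1` cable types with positive fixed costs `σ_0, …, σ_M` increasing
geometrically (factor ≥ 3) and positive incremental costs `β_0, …, β_M`
decreasing geometrically (factor ≤ 1/9), for every `x ≥ 0` and every
`j ∈ {1,…,M}`:
`∑_{i=1}^M min(σ_i, β_{i-1}·x) ≤ (3/2)·σ_j + (9/8)·β_j·x`, and in particular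
`∑_{i=1}^M min(σ_i, β_{i-1}·x) ≤ (3/2)·(σ_j + β_j·x)`. -/
theorem rent_or_buy_pointwise_bound (M : ℕ) (hM : 1 ≤ M)
    (σ β : ℕ → ℝ)
    (hσpos : ∀ i ≤ M, 0 < σ i) (hβpos : ∀ i ≤ M, 0 < β i)
    (hσ : ∀ i, 1 ≤ i → i ≤ M → 3 * σ (i - 1) ≤ σ i)
    (hβ : ∀ i, 1 ≤ i → i ≤ M → β i ≤ β (i - 1) / 9) :
    ∀ x : ℝ, 0 ≤ x → ∀ j, 1 ≤ j → j ≤ M →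
      (∑ i ∈ Finset.Icc 1 M, min (σ i) (β (i - 1) * x)
          ≤ (3 / 2) * σ j + (9 / 8) * β j * x) ∧
      (∑ i ∈ Finset.Icc 1 M, min (σ i) (β (i - 1) * x)
          ≤ (3 / 2) * (σ j + β j * x)) := by
  intro x hx j _ hjM
  have h1 := sum_min_le_of_geometric M σ β (hσpos 0 (by omega)).le hσ hβ x hx j M hjM le_rfl
  have h2 : 0 ≤ β M * x := mul_nonneg (hβpos M le_rfl).le hx
  have h3 : 0 ≤ β j * x := mul_nonneg (hβpos j hjM).le hx
  constructor <;> linarith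
end

section
/- There is a universal constant C such that the following holds. Let (X,d) be a metric space, r ∈ X, and v_1,…,v_k ∈ X (k ≥ 1) be terminals. For i ∈ ℕ let g_i(x) = min(x, 2^i). Let P be a routing of the terminals to r and let ρ ≥ 1. If cost_{g_i}(P) ≤ ρ·OPT_{g_i} for every i ∈ ℕ, then for every nondecreasing concave function f : [0,∞) → [0,∞) with f(0) = 0 one has cost_f(P) ≤ C·ρ·OPT_f. -/
open MeasureTheory
open scoped Classical ENNReal

noncomputable section

variable {X : Type*} [MetricSpace X]

/-- The length of an unordered pair of points: the distance between its endpoints. -/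
def edgeLen (e : Sym2 X) : ℝ :=
  Sym2.lift ⟨fun x y => dist x y, fun x y => dist_comm x y⟩ e

/-- The edges of a path: the unordered pairs of consecutive points. -/
def edgeList (p : List X) : List (Sym2 X) :=
  (p.zip p.tail).map fun ab => s(ab.1, ab.2)

/-- `p` is a path from `v` to `r`: a finite sequence of points starting at `v`
and ending at `r`. -/
def IsPath (v r : X) (p : List X) : Prop :=
  p.head? = some v ∧ p.getLast? = some r

/-- All edges occurring in some path of a routing. -/
def allEdges {k : ℕ} (P : Fin k → List X) : Finset (Sym2 X) :=
  Finset.univ.biUnion fun s => (edgeList (P s)).toFinset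

/-- The load of an edge `e` under a routing `P`: the number of indices `s`
such that `e` is an edge of `P s`. -/
def load {k : ℕ} (P : Fin k → List X) (e : Sym2 X) : ℕ :=
  (Finset.univ.filter fun s => e ∈ edgeList (P s)).card

/-- The cost of a routing `P` under the cost function `f`:
`∑_{e : load_e(P) > 0} d(e) · f(load_e(P))`. -/
def costf {k : ℕ} (f : ℝ → ℝ) (P : Fin k → List X) : ℝ :=
  ∑ e ∈ allEdges P, edgeLen e * f (load P e)

/-- The optimal cost, under `f`, of routing the terminals `v` to the root `r`. -/
def OPTf {k : ℕ} (f : ℝ → ℝ) (v : Fin k → X) (r : X) : ℝ :=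
  sInf { c | ∃ P : Fin k → List X, (∀ s, IsPath (v s) r (P s)) ∧ c = costf f P }

/-- The slope of `f` on the `i`-th dyadic interval: `[0, 1]` for `i = 0`, and
`[2 ^ (i - 1), 2 ^ i]` for `i > 0`. -/
def dyadicSlope (f : ℝ → ℝ) : ℕ → ℝ
  | 0 => f 1
  | i + 1 => (f (2 ^ (i + 1)) - f (2 ^ i)) / 2 ^ i

/-- The piecewise linear function, constant on `[2 ^ n, ∞)`, which interpolates `f` at `0` and at
the powers of two up to `2 ^ n`, as a combination of rent-or-buy functions. -/
def dyadicInterp (f : ℝ → ℝ) (n : ℕ) (x : ℝ) : ℝ :=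
  ∑ i ∈ Finset.range n, (dyadicSlope f i - dyadicSlope f (i + 1)) * min x (2 ^ i) +
    dyadicSlope f n * min x (2 ^ n)

theorem dyadicInterp_succ (f : ℝ → ℝ) (n : ℕ) (x : ℝ) :
    dyadicInterp f (n + 1) x = dyadicInterp f n x +
      dyadicSlope f (n + 1) * (min x (2 ^ (n + 1)) - min x (2 ^ n)) := by
  simp only [dyadicInterp, Finset.sum_range_succ]
  ring

theorem dyadicInterp_of_le (f : ℝ → ℝ) (n : ℕ) {x : ℝ} (hx : 2 ^ n ≤ x) :
    dyadicInterp f n x = f (2 ^ n) := by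
  induction n with
  | zero => simp_all [dyadicInterp, dyadicSlope]
  | succ n ih =>
    have h2 : (0 : ℝ) < 2 ^ n := by positivity
    have hn : (2 : ℝ) ^ n ≤ 2 ^ (n + 1) := by rw [pow_succ]; linarith
    rw [dyadicInterp_succ, ih (hn.trans hx), min_eq_right hx, min_eq_right (hn.trans hx),
      dyadicSlope]
    field_simp
    ring

theorem dyadicSlope_nonneg {f : ℝ → ℝ} (hf : MonotoneOn f (Set.Ici 0)) (h0 : f 0 = 0) (n : ℕ) :
    0 ≤ dyadicSlope f n := by
  cases n with
  | zero => simpa [h0, dyadicSlope] using hf (by simp) (by simp : (1 : ℝ) ∈ Set.Ici 0) zero_le_one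
  | succ n =>
    refine div_nonneg (sub_nonneg.2 (hf (Set.mem_Ici.2 (by positivity))
      (Set.mem_Ici.2 (by positivity)) ?_)) (by positivity)
    exact pow_le_pow_right₀ one_le_two n.le_succ

theorem dyadicSlope_succ_le {f : ℝ → ℝ} (hf : ConcaveOn ℝ (Set.Ici 0) f) (h0 : f 0 = 0) (n : ℕ) :
    dyadicSlope f (n + 1) ≤ dyadicSlope f n := by
  cases n with
  | zero =>
    have h := hf.slope_anti_adjacent (x := 0) (y := 1) (z := 2) (by simp) (by simp)
      (by norm_num) (by norm_num)
    norm_num [h0] at h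
    norm_num [dyadicSlope]
    linarith
  | succ n =>
    have h2 : (0 : ℝ) < 2 ^ n := by positivity
    have h := hf.slope_anti_adjacent (x := 2 ^ n) (y := 2 ^ (n + 1)) (z := 2 ^ (n + 2))
      (Set.mem_Ici.2 (by positivity)) (Set.mem_Ici.2 (by positivity))
      (by rw [pow_succ]; linarith) (by rw [pow_succ _ (n + 1), pow_succ]; linarith)
    rw [show (2 : ℝ) ^ (n + 2) - 2 ^ (n + 1) = 2 ^ (n + 1) by ring,
      show (2 : ℝ) ^ (n + 1) - 2 ^ n = 2 ^ n by ring] at h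
    exact h

theorem ConcaveOn.map_two_mul_le {f : ℝ → ℝ} (hf : ConcaveOn ℝ (Set.Ici 0) f) (h0 : f 0 = 0)
    {x : ℝ} (hx : 0 ≤ x) : f (2 * x) ≤ 2 * f x := by
  have h := hf.2 (Set.mem_Ici.2 le_rfl) (Set.mem_Ici.2 (by positivity : 0 ≤ 2 * x))
    (by norm_num : (0 : ℝ) ≤ 1 / 2) (by norm_num : (0 : ℝ) ≤ 1 / 2) (by norm_num)
  simp only [smul_eq_mul, h0, mul_zero, zero_add] at h
  rw [show (1 / 2 : ℝ) * (2 * x) = x by ring] at h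
  linarith

/-- Up to `2 ^ n`, the dyadic interpolation of a nondecreasing concave function approximates it
within a factor of two at the natural numbers. -/
theorem dyadicInterp_approx {f : ℝ → ℝ} (hm : MonotoneOn f (Set.Ici 0))
    (hf : ConcaveOn ℝ (Set.Ici 0) f) (h0 : f 0 = 0) (n : ℕ) {m : ℕ} (hmn : m ≤ 2 ^ n) :
    dyadicInterp f n m ≤ f m ∧ f m ≤ 2 * dyadicInterp f n m := by
  induction n with
  | zero =>
    have h1 : 0 ≤ f 1 := dyadicSlope_nonneg hm h0 0
    have : m = 0 ∨ m = 1 := by simp at hmn; omega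
    rcases this with rfl | rfl <;> simp [dyadicInterp, dyadicSlope, h0]
    linarith
  | succ n ih =>
    have h2 : (0 : ℝ) < 2 ^ n := by positivity
    have hmn' : (m : ℝ) ≤ 2 ^ (n + 1) := by exact_mod_cast hmn
    rw [dyadicInterp_succ, min_eq_left hmn']
    rcases le_or_gt m (2 ^ n) with h | h
    · rw [min_eq_left (by exact_mod_cast h : (m : ℝ) ≤ 2 ^ n)]
      simpa using ih h
    · have h' : (2 : ℝ) ^ n < m := by exact_mod_cast h
      have hs := dyadicSlope_nonneg hm h0 (n + 1)
      rw [min_eq_right h'.le, dyadicInterp_of_le f n h'.le]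
      constructor
      · rcases hmn'.eq_or_lt with he | hlt
        · rw [he, dyadicSlope, show (2 : ℝ) ^ (n + 1) - 2 ^ n = 2 ^ n by ring,
            div_mul_cancel₀ _ h2.ne']
          linarith
        · have hsec := hf.slope_anti_adjacent (Set.mem_Ici.2 h2.le)
            (Set.mem_Ici.2 (by positivity : (0 : ℝ) ≤ 2 ^ (n + 1))) h' hlt
          rw [div_le_div_iff₀ (by linarith) (by linarith)] at hsec
          have hd : dyadicSlope f (n + 1) * 2 ^ n = f (2 ^ (n + 1)) - f (2 ^ n) :=
            div_mul_cancel₀ _ h2.ne'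
          rw [pow_succ] at hsec hd
          refine le_of_mul_le_mul_right ?_ h2
          linear_combination hsec + ((m : ℝ) - 2 ^ n) * hd
      · have hle : f m ≤ f (2 ^ (n + 1)) :=
          hm (Set.mem_Ici.2 (by positivity)) (Set.mem_Ici.2 (by positivity)) hmn'
        have hdbl := hf.map_two_mul_le h0 h2.le
        rw [← pow_succ'] at hdbl
        have := mul_nonneg hs (sub_nonneg.2 h'.le)
        linarith

theorem edgeLen_nonneg (e : Sym2 X) : 0 ≤ edgeLen e := by
  induction e using Sym2.ind with
  | _ x y => exact dist_nonneg

theorem costf_mono {k : ℕ} {f g : ℝ → ℝ} (h : ∀ m : ℕ, m ≤ k → f m ≤ g m)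
    (P : Fin k → List X) : costf f P ≤ costf g P :=
  Finset.sum_le_sum fun e _ => mul_le_mul_of_nonneg_left
    (h _ ((Finset.card_filter_le _ _).trans (Finset.card_fin k).le)) (edgeLen_nonneg e)

theorem costf_nonneg {k : ℕ} {f : ℝ → ℝ} (h : ∀ m : ℕ, 0 ≤ f m) (P : Fin k → List X) :
    0 ≤ costf f P :=
  Finset.sum_nonneg fun e _ => mul_nonneg (edgeLen_nonneg e) (h _)

theorem costf_const_mul {k : ℕ} (c : ℝ) (f : ℝ → ℝ) (P : Fin k → List X) :
    costf (fun x => c * f x) P = c * costf f P := by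
  simp only [costf, Finset.mul_sum]
  exact Finset.sum_congr rfl fun e _ => by ring

theorem costf_dyadicInterp {k : ℕ} (f : ℝ → ℝ) (n : ℕ) (P : Fin k → List X) :
    costf (dyadicInterp f n) P =
      ∑ i ∈ Finset.range n,
        (dyadicSlope f i - dyadicSlope f (i + 1)) * costf (fun x => min x (2 ^ i)) P +
      dyadicSlope f n * costf (fun x => min x (2 ^ n)) P := by
  simp only [costf, dyadicInterp, mul_add, Finset.sum_add_distrib, Finset.mul_sum]
  rw [Finset.sum_comm]
  congr 1
  · exact Finset.sum_congr rfl fun i _ => Finset.sum_congr rfl fun e _ => by ring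
  · exact Finset.sum_congr rfl fun e _ => by ring

theorem OPTf_le_costf {k : ℕ} {f : ℝ → ℝ} (h : ∀ m : ℕ, 0 ≤ f m) {v : Fin k → X} {r : X}
    {Q : Fin k → List X} (hQ : ∀ s, IsPath (v s) r (Q s)) : OPTf f v r ≤ costf f Q := by
  refine csInf_le ⟨0, ?_⟩ ⟨Q, hQ, rfl⟩
  rintro _ ⟨P, -, rfl⟩
  exact costf_nonneg h P

/-- **Lemma 4 (Rent-or-buy functions form a basis).**
There is a universal constant `C` such that: if a routing `P` of `k ≥ 1`
terminals to a root `r` satisfies `cost_{g_i}(P) ≤ ρ · OPT_{g_i}` for every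
`i : ℕ`, where `g_i(x) = min(x, 2^i)` and `ρ ≥ 1`, then for every nondecreasing
concave `f : [0,∞) → [0,∞)` with `f 0 = 0` one has `cost_f(P) ≤ C·ρ·OPT_f`. -/
theorem rent_or_buy_basis :
    ∃ C : ℝ, 0 < C ∧
      ∀ (X : Type) [MetricSpace X] (r : X) (k : ℕ), 1 ≤ k →
        ∀ (v : Fin k → X) (P : Fin k → List X),
          (∀ s, IsPath (v s) r (P s)) →
          ∀ ρ : ℝ, 1 ≤ ρ →
            (∀ i : ℕ,
              costf (fun x => min x ((2 : ℝ) ^ i)) P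
                ≤ ρ * OPTf (fun x => min x ((2 : ℝ) ^ i)) v r) →
            ∀ f : ℝ → ℝ,
              MonotoneOn f (Set.Ici 0) → ConcaveOn ℝ (Set.Ici 0) f → f 0 = 0 →
              costf f P ≤ C * ρ * OPTf f v r := by
  refine ⟨2, two_pos, fun X _ r k _ v P hP ρ hρ hbasis f hm hf h0 => ?_⟩
  have hρ0 : 0 < 2 * ρ := by linarith
  have approx {m : ℕ} (h : m ≤ k) := dyadicInterp_approx hm hf h0 k (h.trans k.lt_two_pow_self.le)
  rw [← div_le_iff₀' hρ0]
  refine le_csInf ⟨_, P, hP, rfl⟩ ?_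
  rintro _ ⟨Q, hQ, rfl⟩
  rw [div_le_iff₀' hρ0]
  have hbuy (i : ℕ) : costf (fun x => min x ((2 : ℝ) ^ i)) P ≤
      ρ * costf (fun x => min x ((2 : ℝ) ^ i)) Q :=
    (hbasis i).trans (mul_le_mul_of_nonneg_left
      (OPTf_le_costf (fun m => by positivity) hQ) (by linarith))
  have hinterp : costf (dyadicInterp f k) P ≤ ρ * costf (dyadicInterp f k) Q := by
    rw [costf_dyadicInterp, costf_dyadicInterp, mul_add, Finset.mul_sum]
    refine add_le_add (Finset.sum_le_sum fun i _ => ?_) ?_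
    · rw [mul_left_comm]
      exact mul_le_mul_of_nonneg_left (hbuy i) (sub_nonneg.2 (dyadicSlope_succ_le hf h0 i))
    · rw [mul_left_comm]
      exact mul_le_mul_of_nonneg_left (hbuy k) (dyadicSlope_nonneg hm h0 k)
  calc costf f P ≤ costf (fun x => 2 * dyadicInterp f k x) P :=
        costf_mono (fun m h => (approx h).2) P
    _ = 2 * costf (dyadicInterp f k) P := costf_const_mul _ _ P
    _ ≤ 2 * (ρ * costf (dyadicInterp f k) Q) := by linarith
    _ = 2 * ρ * costf (dyadicInterp f k) Q := by ring
    _ ≤ 2 * ρ * costf f Q :=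
        mul_le_mul_of_nonneg_left (costf_mono (fun m h => (approx h).1) Q) hρ0.le
end
end

section
/- Let N ∈ ℕ, let a_0,…,a_N and b_0,…,b_N be nonnegative reals satisfying a_i ≤ 3·(b_i + Σ_{j=0}^{i−1} a_j) for every i ∈ {0,…,N}, and let β_0,…,β_N be nonnegative reals with β_{j+1} ≤ β_j/9 for every j ∈ {0,…,N−1}. Then Σ_{i=0}^{N} β_i·a_i ≤ 6·Σ_{i=0}^{N} β_i·b_i. -/
/-- The potential `5·∑ β_i·a_i + 3·β_n·∑ a_i` is controlled by the weighted total of the `b_i`. -/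
lemma weighted_sum_add_potential_le {N : ℕ} {a b β : ℕ → ℝ}
    (ha : ∀ i ≤ N, 0 ≤ a i)
    (hrec : ∀ i ≤ N, a i ≤ 3 * (b i + ∑ j ∈ Finset.range i, a j))
    (hβ0 : ∀ i ≤ N, 0 ≤ β i)
    (hβ : ∀ j < N, β (j + 1) ≤ β j / 9) {n : ℕ} (hn : n ≤ N) :
    5 * ∑ i ∈ Finset.range (n + 1), β i * a i + 3 * (β n * ∑ i ∈ Finset.range (n + 1), a i)
      ≤ 24 * ∑ i ∈ Finset.range (n + 1), β i * b i := by
  induction n with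
  | zero =>
    have h := mul_le_mul_of_nonneg_left (hrec 0 hn) (hβ0 0 hn)
    simp only [Finset.sum_range_zero, Finset.sum_range_one, zero_add] at h ⊢
    linarith
  | succ n ih =>
    have h := mul_le_mul_of_nonneg_left (hrec (n + 1) hn) (hβ0 (n + 1) hn)
    have hA : 0 ≤ ∑ i ∈ Finset.range (n + 1), a i :=
      Finset.sum_nonneg fun i hi => ha i (by have := Finset.mem_range.mp hi; omega)
    have hdecay := mul_le_mul_of_nonneg_right (hβ n hn) hA
    have ih := ih (Nat.le_of_succ_le hn)
    rw [Finset.sum_range_succ _ (n + 1), Finset.sum_range_succ _ (n + 1),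
      Finset.sum_range_succ _ (n + 1)]
    linarith

/-- **Incremental-cost bound (Lemma 5), abstract form.**
If nonnegative reals `a_0, …, a_N`, `b_0, …, b_N` satisfy
`a_i ≤ 3·(b_i + ∑_{j<i} a_j)` for every `i ≤ N`, and the nonnegative weights
`β_0, …, β_N` decrease geometrically (`β_{j+1} ≤ β_j/9`), then
`∑_{i=0}^N β_i·a_i ≤ 6·∑_{i=0}^N β_i·b_i`. -/
theorem incremental_cost_bound (N : ℕ) (a b β : ℕ → ℝ)
    (ha : ∀ i ≤ N, 0 ≤ a i) (hb : ∀ i ≤ N, 0 ≤ b i)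
    (hrec : ∀ i ≤ N, a i ≤ 3 * (b i + ∑ j ∈ Finset.range i, a j))
    (hβ0 : ∀ i ≤ N, 0 ≤ β i)
    (hβ : ∀ j < N, β (j + 1) ≤ β j / 9) :
    ∑ i ∈ Finset.range (N + 1), β i * a i
      ≤ 6 * ∑ i ∈ Finset.range (N + 1), β i * b i := by
  have h := weighted_sum_add_potential_le ha hrec hβ0 hβ le_rfl
  have hA : 0 ≤ ∑ i ∈ Finset.range (N + 1), a i :=
    Finset.sum_nonneg fun i hi => ha i (Finset.mem_range_succ_iff.mp hi)
  have hB : 0 ≤ ∑ i ∈ Finset.range (N + 1), β i * b i :=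
    Finset.sum_nonneg fun i hi =>
      mul_nonneg (hβ0 i (Finset.mem_range_succ_iff.mp hi)) (hb i (Finset.mem_range_succ_iff.mp hi))
  linarith [mul_nonneg (hβ0 N le_rfl) hA]
end
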